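/- Let α > 1 be an irrational real number. Then as t → 0⁺, the derivative L_α'(t) satisfies L_α'(t) = −π²/(6αt²) + (1 − α^{−1})/(2t) + o(1/t). -/

import Mathlib

open Filter Topology Real Asymptotics

/-- `L_α(t) = -∑_{ℓ ≥ 1} log(1 - e^{-t⌊αℓ⌋})`. -/
noncomputable def LBeatty (α : ℝ) (t : ℝ) : ℝ :=
  -∑' ℓ : ℕ, Real.log (1 - Real.exp (-t * (⌊α * (ℓ + 1)⌋ : ℤ)))

noncomputable def bf (x : ℝ) : ℝ := x / (Real.exp x - 1)

lemma bf_nonneg {x : ℝ} (hx : 0 < x) : 0 ≤ bf x := by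
  have := Real.add_one_le_exp x
  unfold bf
  apply div_nonneg hx.le; linarith

lemma bf_le_one {x : ℝ} (hx : 0 < x) : bf x ≤ 1 := by
  have := Real.add_one_le_exp x
  unfold bf
  rw [div_le_one (by linarith)]; linarith

lemma exp_sub_one_ge {x : ℝ} (hx : 0 < x) : x ^ 3 / 6 ≤ Real.exp x - 1 := by
  have := Real.sum_le_exp_of_nonneg hx.le 4
  simp [Finset.sum_range_succ, Nat.factorial] at this
  nlinarith [sq_nonneg x]

lemma bf_le {x : ℝ} (hx : 0 < x) : bf x ≤ 6 / x ^ 2 := by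
  have := exp_sub_one_ge hx
  have h3 : 0 < x ^ 3 / 6 := by positivity
  unfold bf
  calc x / (Real.exp x - 1) ≤ x / (x ^ 3 / 6) := by gcongr
    _ = 6 / x ^ 2 := by field_simp

lemma bf_hasDerivAt {x : ℝ} (hx : 0 < x) :
    HasDerivAt bf ((Real.exp x - 1 - x * Real.exp x) / (Real.exp x - 1) ^ 2) x := by
  have := Real.add_one_le_exp x
  have h := (hasDerivAt_id x).div ((Real.hasDerivAt_exp x).sub_const 1) (by linarith)
  convert! h using 1
  simp

lemma bf_hasDerivAt2 {x : ℝ} (hx : 0 < x) :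
    HasDerivAt (fun x => (Real.exp x - 1 - x * Real.exp x) / (Real.exp x - 1) ^ 2)
      (Real.exp x * ((x - 2) * Real.exp x + x + 2) / (Real.exp x - 1) ^ 3) x := by
  have := Real.add_one_le_exp x
  have h0 : Real.exp x - 1 ≠ 0 := by linarith
  have h := (((Real.hasDerivAt_exp x).sub_const 1).sub
    ((hasDerivAt_id x).mul (Real.hasDerivAt_exp x))).div
    (((Real.hasDerivAt_exp x).sub_const 1).pow 2) (pow_ne_zero 2 h0)
  convert! h using 1
  simp
  field_simp
  ring

lemma key_exp {x : ℝ} (hx : 0 ≤ x) : 0 ≤ (x - 2) * Real.exp x + x + 2 := by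
  have hd : ∀ y : ℝ, HasDerivAt (fun x => (x - 2) * Real.exp x + x + 2) 
      ((y - 1) * Real.exp y + 1) y := by
    intro y
    have h := (((((hasDerivAt_id y).sub_const 2).mul (Real.hasDerivAt_exp y)).add 
      (hasDerivAt_id y)).add_const 2)
    convert! h using 1
    simp; ring
  have hm : Monotone (fun x => (x - 2) * Real.exp x + x + 2) := by
    apply monotone_of_deriv_nonneg (fun y => (hd y).differentiableAt)
    intro y
    rw [(hd y).deriv]
    have h1 := Real.add_one_le_exp (-y)
    have h2 : Real.exp (-y) * Real.exp y = 1 := by rw [← Real.exp_add]; simp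
    nlinarith [Real.exp_pos y]
  have := hm hx
  simpa using this

lemma bf_convex : ConvexOn ℝ (Set.Ioi 0) bf := by
  refine convexOn_of_hasDerivWithinAt2_nonneg (convex_Ioi 0)
    (f' := fun x => (Real.exp x - 1 - x * Real.exp x) / (Real.exp x - 1) ^ 2)
    (f'' := fun x => Real.exp x * ((x - 2) * Real.exp x + x + 2) / (Real.exp x - 1) ^ 3)
    (fun x hx => (bf_hasDerivAt hx).continuousAt.continuousWithinAt) ?_ ?_ ?_
  · intro x hx
    rw [interior_Ioi] at hx
    exact (bf_hasDerivAt hx).hasDerivWithinAt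
  · intro x hx
    rw [interior_Ioi] at hx
    exact (bf_hasDerivAt2 hx).hasDerivWithinAt
  · intro x hx
    rw [interior_Ioi] at hx
    have hx : 0 < x := hx
    have := Real.add_one_le_exp x
    have h0 : 0 < Real.exp x - 1 := by linarith
    have := key_exp hx.le
    positivity

lemma bf_anti : AntitoneOn bf (Set.Ioi 0) := by
  apply antitoneOn_of_deriv_nonpos (convex_Ioi 0)
    (fun x hx => (bf_hasDerivAt hx).continuousAt.continuousWithinAt)
  · intro x hx
    rw [interior_Ioi] at hx
    exact (bf_hasDerivAt hx).differentiableAt.differentiableWithinAt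
  · intro x hx
    rw [interior_Ioi] at hx
    have hx : 0 < x := hx
    rw [(bf_hasDerivAt hx).deriv]
    have h1 := Real.add_one_le_exp (-x)
    have h2 : Real.exp (-x) * Real.exp x = 1 := by rw [← Real.exp_add]; simp
    apply div_nonpos_of_nonpos_of_nonneg
    · nlinarith [Real.exp_pos x]
    · positivity

lemma bf_tendsto : Tendsto bf (𝓝[>] 0) (𝓝 1) := by
  have h := (Real.hasDerivAt_exp 0).tendsto_slope_zero_right
  simp only [zero_add, Real.exp_zero, smul_eq_mul] at h
  have h2 := h.inv₀ one_ne_zero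
  simp only [inv_one] at h2
  refine h2.congr fun x => ?_
  simp [bf, div_eq_mul_inv, mul_comm]

lemma bf_convex_step {x t : ℝ} (hx : 0 < x) (ht : 0 < t) :
    bf (x + t) - bf (x + t + t) ≤ bf x - bf (x + t) := by
  have h := bf_convex.2 (show x ∈ Set.Ioi 0 from hx) 
    (show x + t + t ∈ Set.Ioi 0 by simp; positivity) (show (0 : ℝ) ≤ 1 / 2 by norm_num)
    (show (0 : ℝ) ≤ 1 / 2 by norm_num) (by norm_num)
  have e : (1/2 : ℝ) • x + (1/2 : ℝ) • (x + t + t) = x + t := by simp; ring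
  rw [e] at h
  simp only [smul_eq_mul] at h
  linarith

lemma sq_summable : Summable (fun n : ℕ => 1 / ((n : ℝ) + 1) ^ 2) := by
  have := (summable_nat_add_iff 1).2 (Real.summable_one_div_nat_pow.2 (show 1 < 2 by norm_num))
  simpa using this

lemma bf_bound {t : ℝ} (ht : 0 < t) (n : ℕ) : bf (t * (n + 1)) ≤ 6 / t ^ 2 * (1 / ((n : ℝ) + 1) ^ 2) := by
  refine (bf_le (by positivity)).trans (le_of_eq ?_)
  field_simp

lemma bf_summable {t : ℝ} (ht : 0 < t) : Summable (fun n : ℕ => bf (t * (n + 1))) :=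
  Summable.of_nonneg_of_le (fun n => bf_nonneg (by positivity)) (bf_bound ht)
    (sq_summable.mul_left _)

noncomputable def bP (t : ℝ) : ℝ := ∑' n : ℕ, bf (t * (n + 1))

lemma bP_tendsto : Tendsto (fun t : ℝ => bP (4 * π ^ 2 / t)) (𝓝[>] 0) (𝓝 0) := by
  have h0 : Tendsto (fun t : ℝ => 6 / (4 * π ^ 2 / t) ^ 2 * ∑' n : ℕ, (1 / ((n : ℝ) + 1) ^ 2))
      (𝓝[>] 0) (𝓝 0) := by
    have : Continuous (fun t : ℝ => 6 * t ^ 2 / (4 * π ^ 2) ^ 2 * ∑' n : ℕ, (1 / ((n : ℝ) + 1) ^ 2)) := by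
      fun_prop
    have := (this.tendsto 0).mono_left (nhdsWithin_le_nhds (s := Set.Ioi 0))
    simp only [ne_eq, OfNat.ofNat_ne_zero, not_false_eq_true, zero_pow, mul_zero, zero_div, zero_mul] at this
    refine this.congr fun t => ?_
    rw [div_pow, div_div_eq_mul_div]
  refine tendsto_of_tendsto_of_tendsto_of_le_of_le' tendsto_const_nhds h0 ?_ ?_
  · filter_upwards [self_mem_nhdsWithin] with t ht
    have ht : 0 < t := ht
    exact tsum_nonneg fun n => bf_nonneg (by positivity)
  · filter_upwards [self_mem_nhdsWithin] with t ht
    have ht : 0 < t := ht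
    have hs : 0 < 4 * π ^ 2 / t := by positivity
    rw [← tsum_mul_left]
    exact (bf_summable hs).tsum_le_tsum (bf_bound hs) (sq_summable.mul_left _)

lemma E2_eq {t : ℝ} (ht : 0 < t) (z : UpperHalfPlane) (hz : (z : ℂ) = Complex.I * (t / (2 * π))) :
    EisensteinSeries.E2 z = ((1 - 24 * (bP t / t) : ℝ) : ℂ) := by
  rw [EisensteinSeries.E2_eq_tsum_cexp]
  have e : Complex.exp (2 * π * Complex.I * z) = ((Real.exp (-t) : ℝ) : ℂ) := by
    rw [hz]
    push_cast
    congr 1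
    have : (π : ℂ) ≠ 0 := by exact_mod_cast Real.pi_ne_zero
    field_simp
    simp
  rw [e]
  have hr : ‖((Real.exp (-t) : ℝ) : ℂ)‖ < 1 := by
    rw [Complex.norm_real]; simp [ht]
  have := tsum_pow_div_one_sub_eq_tsum_sigma hr 1
  rw [← this]
  have h2 : ∑' n : ℕ+, ((n : ℕ) : ℂ) ^ 1 * ((Real.exp (-t) : ℝ) : ℂ) ^ (n : ℕ) / (1 - ((Real.exp (-t) : ℝ) : ℂ) ^ (n : ℕ))
      = ((bP t / t : ℝ) : ℂ) := by
    rw [tsum_pnat_eq_tsum_succ (f := fun n : ℕ => (n : ℂ) ^ 1 * ((Real.exp (-t) : ℝ) : ℂ) ^ n / (1 - ((Real.exp (-t) : ℝ) : ℂ) ^ n))]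
    rw [bP, ← tsum_div_const, Complex.ofReal_tsum]
    congr 1
    ext n
    norm_cast
    rw [← Real.exp_nat_mul]
    have h3 : Real.exp (((n + 1 : ℕ) : ℝ) * -t) = (Real.exp (t * (n + 1)))⁻¹ := by
      rw [← Real.exp_neg]; congr 1; push_cast; ring
    rw [h3, bf]
    have := Real.add_one_le_exp (t * (n + 1))
    have h4 : 0 < t * ((n : ℝ) + 1) := by positivity
    have h5 : Real.exp (t * (n + 1)) - 1 ≠ 0 := by linarith
    have h6 : 1 - (Real.exp (t * (n + 1)))⁻¹ ≠ 0 := by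
      intro h
      apply h5
      have h7 : (Real.exp (t * (n + 1)))⁻¹ = 1 := by linarith
      rw [inv_eq_one] at h7
      linarith
    have := Real.exp_pos (t * (n + 1))
    push_cast
    field_simp
  rw [h2]
  push_cast; ring

lemma bP_eq {t : ℝ} (ht : 0 < t) :
    bP t = π ^ 2 / (6 * t) - 1 / 2 + t / 24 - bP (4 * π ^ 2 / t) := by
  have hpi := Real.pi_pos
  let z : UpperHalfPlane := ⟨Complex.I * (t / (2 * π)), by
    have : (Complex.I * ((t : ℂ) / (2 * π))).im = t / (2 * π) := by
      rw [Complex.I_mul_im]; norm_cast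
    rw [this]; positivity⟩
  have hz : (z : ℂ) = Complex.I * (t / (2 * π)) := rfl
  have h1 := EisensteinSeries.G2_S_transform z
  have hs : 0 < 4 * π ^ 2 / t := by positivity
  have hpc : (π : ℂ) ≠ 0 := by exact_mod_cast Real.pi_ne_zero
  have htc : (t : ℂ) ≠ 0 := by exact_mod_cast ht.ne'
  have hS : ((ModularGroup.S • z : UpperHalfPlane) : ℂ) = Complex.I * (((4 * π ^ 2 / t : ℝ) : ℂ) / (2 * π)) := by
    rw [UpperHalfPlane.modular_S_smul]
    show (-(z : ℂ))⁻¹ = _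
    rw [hz]
    push_cast
    field_simp
    simp [Complex.I_sq]
    try norm_num
  have e1 := E2_eq ht z hz
  have e2 := E2_eq hs _ hS
  have hG : ∀ w, EisensteinSeries.G2 w = (π ^ 2 / 3 : ℂ) * EisensteinSeries.E2 w := by
    intro w
    simp only [EisensteinSeries.E2, Pi.smul_apply, smul_eq_mul, riemannZeta_two]
    field_simp
    ring
  rw [hG, hG, e1, e2, hz] at h1
  set A := bP t
  set B := bP (4 * π ^ 2 / t)
  have h2 : ((π ^ 2 / 3 * (1 - 24 * (A / t)) : ℝ) : ℂ) = ((-(2 * π / t) ^ 2 * (π ^ 2 / 3 * (1 - 24 * (B / (4 * π ^ 2 / t)))) + 4 * π ^ 2 / t : ℝ) : ℂ) := by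
    push_cast
    push_cast at h1
    rw [h1]
    simp only [mul_pow, Complex.I_sq]
    have : Complex.I ≠ 0 := Complex.I_ne_zero
    field_simp
    ring_nf
  have h3 := Complex.ofReal_injective h2
  field_simp at h3 ⊢
  nlinarith

lemma shift_sum (u : ℕ → ℝ) (h0 : ∀ n, 0 ≤ u n) (h1 : ∀ n, u n ≤ 1) (k N : ℕ) :
    |∑ n ∈ Finset.range N, (u (n + k) - u n)| ≤ k := by
  have e : ∑ n ∈ Finset.range N, (u (n + k) - u n)
      = ∑ j ∈ Finset.range k, (u (N + j) - u j) := by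
    rw [Finset.sum_sub_distrib, Finset.sum_sub_distrib]
    have a1 := Finset.sum_range_add u N k
    have a2 := Finset.sum_range_add u k N
    rw [add_comm k N] at a2
    simp only [add_comm k] at a2
    linarith
  rw [e]
  refine (Finset.abs_sum_le_sum_abs _ _).trans ?_
  calc _ ≤ ∑ j ∈ Finset.range k, (1 : ℝ) := by
        apply Finset.sum_le_sum
        intro j _
        rw [abs_le]
        constructor <;> linarith [h0 (N + j), h1 (N + j), h0 j, h1 j]
    _ = k := by simp

lemma fract_avg (β x₀ : ℝ) (hβ : Irrational β) (ε : ℝ) (hε : 0 < ε) :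
    ∃ K : ℝ, 0 ≤ K ∧ ∀ N : ℕ, |∑ n ∈ Finset.range N, (Int.fract (n * β + x₀) - 1 / 2)| ≤ K + ε * N := by
  obtain ⟨m, hm⟩ := exists_nat_one_div_lt (show (0 : ℝ) < ε / 2 by positivity)
  obtain ⟨k, hk0, -, hk⟩ := Real.exists_nat_abs_mul_sub_round_le β (Nat.succ_pos m)
  obtain ⟨δ, hδ⟩ : ∃ δ, δ = k * β - round (k * β) := ⟨_, rfl⟩
  rw [← hδ] at hk
  have hδ0 : δ ≠ 0 := by
    intro h
    have : Irrational (k * β - round (k * β)) := (hβ.natCast_mul hk0.ne').sub_intCast _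
    exact this.ne_zero (by rw [← hδ]; exact h)
  have hm0 : (0 : ℝ) ≤ m := Nat.cast_nonneg m
  have hδε : |δ| ≤ ε / 2 := by
    refine hk.trans (le_trans ?_ hm.le)
    push_cast
    apply one_div_le_one_div_of_le <;> linarith
  have hδ1 : |δ| < 1 := by
    refine hk.trans_lt ?_
    push_cast
    rw [div_lt_one (by positivity)]; linarith
  have hδp : 0 < |δ| := abs_pos.2 hδ0
  obtain ⟨h, hh⟩ : ∃ h : ℕ → ℝ, h = fun n : ℕ => Int.fract (n * β + x₀) := ⟨_, rfl⟩
  have hn0 : ∀ n, 0 ≤ h n := fun n => by rw [hh]; exact Int.fract_nonneg _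
  have hn1 : ∀ n, h n < 1 := fun n => by rw [hh]; exact Int.fract_lt_one _
  have hw : ∀ n, ∃ w : ℤ, h n + δ - h (n + k) = w := by
    intro n
    refine ⟨⌊((n + k : ℕ) : ℝ) * β + x₀⌋ - ⌊(n : ℝ) * β + x₀⌋ - round (k * β), ?_⟩
    simp only [hh, Int.fract, hδ]
    push_cast
    ring
  -- pointwise
  have hpt : ∃ s : ℝ, (s = 1 ∨ s = -1) ∧ s * δ = |δ| ∧ ∀ n,
      |δ * (2 * h n - 1) - ((h n - h n ^ 2) - (h (n + k) - h (n + k) ^ 2))| ≤ 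
        δ ^ 2 + 2 * |δ| * (s * (h n + δ - h (n + k))) := by
    rcases lt_or_gt_of_ne hδ0 with hneg | hpos
    · refine ⟨-1, Or.inr rfl, by rw [abs_of_neg hneg]; ring, fun n => ?_⟩
      rw [abs_of_neg hneg] at hδ1 ⊢
      obtain ⟨w, hw⟩ := hw n
      have b1 : w < 1 := by
        have : (w : ℝ) < 1 := by rw [← hw]; linarith [hn0 (n + k), hn1 n]
        exact_mod_cast this
      have b2 : -2 < w := by
        have : (-2 : ℝ) < w := by rw [← hw]; linarith [hn1 (n + k), hn0 n]
        exact_mod_cast this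
      have a1 := hn0 n
      have a2 := hn0 (n + k)
      have a3 := hn1 n
      have a4 := hn1 (n + k)
      rcases (show w = 0 ∨ w = -1 by omega) with rfl | rfl
      · have e : h (n + k) = h n + δ := by push_cast at hw; linarith
        rw [e, abs_le]; constructor <;> nlinarith
      · have e : h (n + k) = h n + δ + 1 := by push_cast at hw; linarith
        rw [e] at a2 a4 ⊢
        rw [abs_le]; constructor <;> nlinarith
    · refine ⟨1, Or.inl rfl, by rw [abs_of_pos hpos]; ring, fun n => ?_⟩
      rw [abs_of_pos hpos] at hδ1 ⊢
      obtain ⟨w, hw⟩ := hw n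
      have b1 : w < 2 := by
        have : (w : ℝ) < 2 := by rw [← hw]; linarith [hn0 (n + k), hn1 n]
        exact_mod_cast this
      have b2 : -1 < w := by
        have : (-1 : ℝ) < w := by rw [← hw]; linarith [hn1 (n + k), hn0 n]
        exact_mod_cast this
      have a1 := hn0 n
      have a2 := hn0 (n + k)
      have a3 := hn1 n
      have a4 := hn1 (n + k)
      rcases (show w = 0 ∨ w = 1 by omega) with rfl | rfl
      · have e : h (n + k) = h n + δ := by push_cast at hw; linarith
        rw [e, abs_le]; constructor <;> nlinarith
      · have e : h (n + k) = h n + δ - 1 := by push_cast at hw; linarith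
        rw [e] at a2 a4 ⊢
        rw [abs_le]; constructor <;> nlinarith
  obtain ⟨s, hs, hsδ, hpt⟩ := hpt
  refine ⟨(k / |δ| + 2 * k) / 2, by positivity, fun N => ?_⟩
  have s1 := shift_sum h hn0 (fun n => (hn1 n).le) k N
  have s2 := shift_sum (fun n => h n - h n ^ 2) (fun n => by nlinarith [hn0 n, hn1 n])
    (fun n => by nlinarith [hn0 n, hn1 n]) k N
  have key : |∑ n ∈ Finset.range N, (δ * (2 * h n - 1) - ((h n - h n ^ 2) - (h (n + k) - h (n + k) ^ 2)))|
      ≤ ∑ n ∈ Finset.range N, (δ ^ 2 + 2 * |δ| * (s * (h n + δ - h (n + k)))) :=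
    (Finset.abs_sum_le_sum_abs _ _).trans (Finset.sum_le_sum fun n _ => hpt n)
  have r1 : ∑ n ∈ Finset.range N, (δ ^ 2 + 2 * |δ| * (s * (h n + δ - h (n + k))))
      = N * (3 * |δ| ^ 2) - 2 * |δ| * (s * ∑ n ∈ Finset.range N, (h (n + k) - h n)) := by
    have : ∀ n, δ ^ 2 + 2 * |δ| * (s * (h n + δ - h (n + k))) 
        = 3 * |δ| ^ 2 - 2 * |δ| * (s * (h (n + k) - h n)) := by
      intro n
      have : s * (h n + δ - h (n + k)) = |δ| - s * (h (n + k) - h n) := by rw [← hsδ]; ring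
      rw [this, ← sq_abs δ]; ring
    simp_rw [this]
    rw [Finset.sum_sub_distrib, Finset.sum_const,
      Finset.card_range, nsmul_eq_mul, Finset.mul_sum, Finset.mul_sum]
  have r2 : ∑ n ∈ Finset.range N, (δ * (2 * h n - 1) - ((h n - h n ^ 2) - (h (n + k) - h (n + k) ^ 2)))
      = 2 * δ * (∑ n ∈ Finset.range N, (h n - 1 / 2))
        + ∑ n ∈ Finset.range N, ((h (n + k) - h (n + k) ^ 2) - (h n - h n ^ 2)) := by
    rw [Finset.mul_sum, ← Finset.sum_add_distrib]
    apply Finset.sum_congr rfl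
    intros; ring
  rw [r1, r2] at key
  have s1' : |s * ∑ n ∈ Finset.range N, (h (n + k) - h n)| ≤ k := by
    rcases hs with rfl | rfl
    · rw [one_mul]; exact s1
    · rw [neg_one_mul, abs_neg]; exact s1
  set X := ∑ n ∈ Finset.range N, (h n - 1 / 2) with hX
  set Y := s * ∑ n ∈ Finset.range N, (h (n + k) - h n)
  set Z := ∑ n ∈ Finset.range N, ((h (n + k) - h (n + k) ^ 2) - (h n - h n ^ 2))
  have hXX : ∑ n ∈ Finset.range N, (Int.fract (n * β + x₀) - 1 / 2) = X := by rw [hX, hh]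
  rw [hXX]
  have f1 : |2 * δ * X| ≤ N * (3 * |δ| ^ 2) + 2 * |δ| * k + k := by
    have := abs_sub_abs_le_abs_sub (2 * δ * X) (-Z)
    rw [abs_neg, sub_neg_eq_add] at this
    have h3 : -(2 * |δ| * Y) ≤ 2 * |δ| * k := by
      have := (abs_le.1 s1').1
      nlinarith
    linarith
  rw [abs_mul, abs_mul, abs_two] at f1
  have hN : (0 : ℝ) ≤ N := Nat.cast_nonneg N
  have f2 : |X| ≤ (k / |δ| + 2 * k) / 2 + 3 / 2 * |δ| * N := by
    have e : 2 * |δ| * ((k / |δ| + 2 * k) / 2 + 3 / 2 * |δ| * N) = N * (3 * |δ| ^ 2) + 2 * |δ| * k + k := by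
      field_simp; ring
    rw [← e] at f1
    exact le_of_mul_le_mul_left f1 (by positivity)
  refine f2.trans ?_
  have : 3 / 2 * |δ| * N ≤ ε * N := by
    apply mul_le_mul_of_nonneg_right _ hN
    linarith
  linarith

lemma abel_bound (c d : ℕ → ℝ) (hd : Antitone d) (hd0 : ∀ n, 0 ≤ d n) (K ε : ℝ) 
    (hc : ∀ N : ℕ, |∑ n ∈ Finset.range N, c n| ≤ K + ε * N) (N : ℕ) :
    |∑ n ∈ Finset.range N, c n * d n| ≤ K * d 0 + ε * ∑ n ∈ Finset.range N, d n := by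
  have e1 : ∀ N : ℕ, ∑ n ∈ Finset.range N, c n * d n = (∑ n ∈ Finset.range N, c n) * d N
      + ∑ n ∈ Finset.range N, (∑ i ∈ Finset.range (n + 1), c i) * (d n - d (n + 1)) := by
    intro N
    induction N with
    | zero => simp
    | succ N ih =>
      rw [Finset.sum_range_succ, ih, Finset.sum_range_succ _ N, Finset.sum_range_succ _ N]
      simp only [Finset.sum_range_succ c N]
      ring
  have e2 : ∀ N : ℕ, (K + ε * N) * d N + ∑ n ∈ Finset.range N, (K + ε * ((n + 1 : ℕ) : ℝ)) * (d n - d (n + 1))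
      = K * d 0 + ε * ∑ n ∈ Finset.range N, d n := by
    intro N
    induction N with
    | zero => simp
    | succ N ih =>
      rw [Finset.sum_range_succ, Finset.sum_range_succ d N, mul_add, ← add_assoc (K * d 0), ← ih]
      push_cast
      ring
  rw [e1, ← e2]
  refine (abs_add_le _ _).trans (add_le_add ?_ ?_)
  · rw [abs_mul, abs_of_nonneg (hd0 N)]
    exact mul_le_mul_of_nonneg_right (hc N) (hd0 N)
  · refine (Finset.abs_sum_le_sum_abs _ _).trans (Finset.sum_le_sum fun n _ => ?_)
    have : 0 ≤ d n - d (n + 1) := sub_nonneg.2 (hd (Nat.le_succ n))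
    rw [abs_mul, abs_of_nonneg this]
    exact mul_le_mul_of_nonneg_right (hc (n + 1)) this

noncomputable def bT (β t : ℝ) : ℝ :=
  ∑' n : ℕ, (Int.fract ((n + 2) * β) - Int.fract ((n + 1) * β)) * bf (t * (n + 1))

lemma bT_summable (β : ℝ) {t : ℝ} (ht : 0 < t) : Summable (fun n : ℕ =>
    (Int.fract ((n + 2) * β) - Int.fract ((n + 1) * β)) * bf (t * (n + 1))) := by
  refine Summable.of_norm_bounded (bf_summable ht) fun n => ?_
  have hb : 0 ≤ bf (t * (n + 1)) := bf_nonneg (by positivity)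
  rw [norm_mul, Real.norm_of_nonneg hb]
  refine mul_le_of_le_one_left hb ?_
  rw [Real.norm_eq_abs, abs_le]
  constructor <;> linarith [Int.fract_nonneg (((n : ℝ) + 2) * β), Int.fract_lt_one (((n : ℝ) + 2) * β),
    Int.fract_nonneg (((n : ℝ) + 1) * β), Int.fract_lt_one (((n : ℝ) + 1) * β)]

lemma bT_bound (β : ℝ) (K ε : ℝ) (hε : 0 < ε)
    (hc : ∀ N : ℕ, |∑ n ∈ Finset.range N, (Int.fract (n * β + 2 * β) - 1 / 2)| ≤ K + ε * N)
    {t : ℝ} (ht : 0 < t) :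
    |bT β t + (Int.fract β - 1 / 2) * bf t| ≤ K * (bf t - bf (2 * t)) + ε := by
  set F : ℕ → ℝ := fun n => bf (t * (n + 1)) with hF
  set a : ℕ → ℝ := fun n => Int.fract ((n + 1) * β) - 1 / 2 with ha
  have hFs : Tendsto F atTop (𝓝 0) := (bf_summable ht).tendsto_atTop_zero
  have hFn : ∀ n, 0 ≤ F n := fun n => bf_nonneg (by positivity)
  have hda : Antitone (fun n => F n - F (n + 1)) := by
    apply antitone_nat_of_succ_le
    intro n
    have := bf_convex_step (x := t * (n + 1)) (t := t) (by positivity) ht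
    simp only [hF]
    push_cast
    convert! this using 3 <;> ring
  have hd0 : ∀ n, 0 ≤ F n - F (n + 1) := by
    intro n
    rw [sub_nonneg]
    apply bf_anti (show (0 : ℝ) < _ by positivity) (show (0 : ℝ) < _ by positivity)
    push_cast
    nlinarith
  have hab := abel_bound (fun n => a (n + 1)) _ hda hd0 K ε (by
    intro N
    refine le_trans (le_of_eq ?_) (hc N)
    congr 2
    ext n
    simp only [ha]
    congr 2
    push_cast; ring)
  have hF0 : F 0 = bf t := by simp [hF]
  have hF1 : F 1 = bf (2 * t) := by simp only [hF]; congr 1; push_cast; ring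
  have hsum : HasSum (fun n : ℕ => (a (n + 1) - a n) * F n) (bT β t) := by
    have := (bT_summable β ht).hasSum
    convert! this using 2 with n
    simp only [ha, hF]
    push_cast
    ring_nf
  have hlim := (hsum.tendsto_sum_nat.add_const ((Int.fract β - 1 / 2) * bf t)).abs
  have hlim2 : Tendsto (fun N => F N + (K * (bf t - bf (2 * t)) + ε)) atTop 
      (𝓝 (0 + (K * (bf t - bf (2 * t)) + ε))) := hFs.add_const _
  rw [zero_add] at hlim2
  refine le_of_tendsto_of_tendsto' hlim hlim2 fun N => ?_
  have e : ∀ N : ℕ, ∑ n ∈ Finset.range N, (a (n + 1) - a n) * F n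
      = a N * F N - a 0 * F 0 + ∑ n ∈ Finset.range N, a (n + 1) * (F n - F (n + 1)) := by
    intro N
    induction N with
    | zero => simp
    | succ N ih => rw [Finset.sum_range_succ, ih, Finset.sum_range_succ _ N]; ring
  have a0 : a 0 = Int.fract β - 1 / 2 := by simp [ha]
  rw [e, a0, hF0]
  have hab := hab N
  have htel : ∑ n ∈ Finset.range N, (F n - F (n + 1)) ≤ 1 := by
    rw [Finset.sum_range_sub']
    have := hFn N
    have := bf_le_one ht
    rw [hF0]; linarith
  rw [zero_add, hF0, hF1] at hab
  have haN : |a N * F N| ≤ F N := by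
    rw [abs_mul, abs_of_nonneg (hFn N)]
    refine mul_le_of_le_one_left (hFn N) ?_
    rw [abs_le]
    simp only [ha]
    constructor <;> linarith [Int.fract_nonneg (((N : ℝ) + 1) * β), Int.fract_lt_one (((N : ℝ) + 1) * β)]
  have h5 : ε * ∑ n ∈ Finset.range N, (F n - F (n + 1)) ≤ ε := mul_le_of_le_one_right hε.le htel
  have := abs_add_le (a N * F N) (∑ n ∈ Finset.range N, a (n + 1) * (F n - F (n + 1)))
  have e3 : ∀ x y z : ℝ, x - z + y + z = x + y := by intros; ring
  rw [e3]
  linarith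

lemma bf_tendsto2 : Tendsto (fun t => bf (2 * t)) (𝓝[>] 0) (𝓝 1) := by
  refine bf_tendsto.comp ?_
  refine tendsto_nhdsWithin_of_tendsto_nhds_of_eventually_within _ ?_ ?_
  · have : Continuous (fun t : ℝ => 2 * t) := by fun_prop
    simpa using (this.tendsto 0).mono_left (nhdsWithin_le_nhds (s := Set.Ioi 0))
  · filter_upwards [self_mem_nhdsWithin] with t ht
    have ht : 0 < t := ht
    show 0 < 2 * t
    positivity

lemma bT_tendsto (β : ℝ) (hβ : Irrational β) :
    Tendsto (fun t => bT β t + (Int.fract β - 1 / 2) * bf t) (𝓝[>] 0) (𝓝 0) := by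
  rw [Metric.tendsto_nhds]
  intro ε hε
  obtain ⟨K, hK, hc⟩ := fract_avg β (2 * β) hβ (ε / 2) (by positivity)
  have h1 : Tendsto (fun t => K * (bf t - bf (2 * t))) (𝓝[>] 0) (𝓝 (K * (1 - 1))) :=
    (bf_tendsto.sub bf_tendsto2).const_mul K
  rw [sub_self, mul_zero] at h1
  filter_upwards [self_mem_nhdsWithin, h1.eventually (gt_mem_nhds (show 0 < ε / 2 by positivity))] with t ht h2
  have := bT_bound β K (ε / 2) (by positivity) hc ht
  rw [Real.dist_eq, sub_zero]
  linarith

lemma floor_ge {α : ℝ} (hα : 1 < α) (l : ℕ) : (l : ℝ) + 1 ≤ (⌊α * (l + 1)⌋ : ℤ) := by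
  have : ((l + 1 : ℕ) : ℤ) ≤ ⌊α * (l + 1)⌋ := by
    rw [Int.le_floor]
    push_cast
    have : (0 : ℝ) ≤ l := Nat.cast_nonneg l
    nlinarith
  exact_mod_cast this

lemma S_eq {α : ℝ} (hα : 1 < α) (hirr : Irrational α) {t : ℝ} (ht : 0 < t) :
    ∑' l : ℕ, bf (t * (⌊α * (l + 1)⌋ : ℤ)) = α⁻¹ * bP t - bT α⁻¹ t := by
  have hα0 : 0 < α := by linarith
  set β := α⁻¹ with hβ
  have hβirr : Irrational β := hirr.inv
  have hβ0 : 0 < β := inv_pos.2 hα0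
  have hβ1 : β < 1 := inv_lt_one_of_one_lt₀ hα
  have hαβ : α * β = 1 := mul_inv_cancel₀ hα0.ne'
  rw [bP, bT, ← tsum_mul_left, ← ((bf_summable ht).mul_left β).tsum_sub (bT_summable β ht)]
  obtain ⟨ν, hν⟩ : ∃ ν : ℕ → ℕ, ∀ l, ((ν l : ℤ) + 1) = ⌊α * (l + 1)⌋ := by
    have : ∀ l : ℕ, ∃ m : ℕ, ((m : ℤ) + 1) = ⌊α * (l + 1)⌋ := by
      intro l
      refine ⟨(⌊α * (l + 1)⌋ - 1).toNat, ?_⟩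
      have h := floor_ge hα l
      have h0 : (0 : ℝ) ≤ l := Nat.cast_nonneg l
      have : (1 : ℤ) ≤ ⌊α * (l + 1)⌋ := by
        have : ((1 : ℤ) : ℝ) ≤ ⌊α * (l + 1)⌋ := by push_cast; linarith
        exact_mod_cast this
      omega
    choose ν hν using this
    exact ⟨ν, hν⟩
  have hνb : ∀ l, (ν l : ℝ) + 1 ≤ α * (l + 1) ∧ α * (l + 1) < ν l + 2 := by
    intro l
    have h1 := Int.floor_le (α * (l + 1))
    have h2 := Int.lt_floor_add_one (α * (l + 1))
    rw [← hν] at h1 h2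
    push_cast at h1 h2
    constructor <;> linarith
  have hinj : Function.Injective ν := by
    have : StrictMono ν := by
      apply strictMono_nat_of_lt_succ
      intro l
      have h1 := (hνb l).1
      have h2 := (hνb (l + 1)).2
      push_cast at h2
      have : (ν l : ℝ) < ν (l + 1) := by nlinarith
      exact_mod_cast this
    exact this.injective
  have hg : ∀ n : ℕ, β * bf (t * (n + 1)) - (Int.fract ((n + 2) * β) - Int.fract ((n + 1) * β)) * bf (t * (n + 1))
      = ((⌊((n : ℝ) + 2) * β⌋ - ⌊((n : ℝ) + 1) * β⌋ : ℤ) : ℝ) * bf (t * (n + 1)) := by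
    intro n
    simp only [Int.fract]
    push_cast
    ring
  simp_rw [hg]
  rw [← hinj.tsum_eq (f := fun n : ℕ => ((⌊((n : ℝ) + 2) * β⌋ - ⌊((n : ℝ) + 1) * β⌋ : ℤ) : ℝ)
    * bf (t * (n + 1)))]
  · apply tsum_congr
    intro l
    have h1 := hνb l
    have e1 : ⌊((ν l : ℝ) + 2) * β⌋ - ⌊((ν l : ℝ) + 1) * β⌋ = 1 := by
      have i1 : ((l + 1 : ℕ) : ℤ) ≤ ⌊((ν l : ℝ) + 2) * β⌋ := by
        rw [Int.le_floor]; push_cast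
        nlinarith
      have i2 : ⌊((ν l : ℝ) + 1) * β⌋ < ((l + 1 : ℕ) : ℤ) := by
        rw [Int.floor_lt]; push_cast
        have hne : ((ν l : ℝ) + 1) * β ≠ l + 1 := by
          intro h
          have : Irrational (((ν l + 1 : ℕ) : ℝ) * β) := hβirr.natCast_mul (by omega)
          apply this.ne_nat (l + 1)
          push_cast
          exact h
        refine lt_of_le_of_ne ?_ hne
        have := mul_le_mul_of_nonneg_right h1.1 hβ0.le
        nlinarith
      have i3 : ⌊((ν l : ℝ) + 2) * β⌋ ≤ ⌊((ν l : ℝ) + 1) * β⌋ + 1 := by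
        rw [← Int.floor_add_one]
        apply Int.floor_mono
        nlinarith
      omega
    simp only [e1, ← hν]
    push_cast
    ring
  · intro n hn
    rw [Function.mem_support] at hn
    have hne : ⌊((n : ℝ) + 2) * β⌋ - ⌊((n : ℝ) + 1) * β⌋ ≠ 0 := by
      intro h
      apply hn
      simp [h]
    have hmono : ⌊((n : ℝ) + 1) * β⌋ ≤ ⌊((n : ℝ) + 2) * β⌋ := Int.floor_mono (by nlinarith)
    set k := ⌊((n : ℝ) + 2) * β⌋ with hk
    have k1 : ((n : ℝ) + 1) * β < k := by
      rw [← Int.floor_lt]; omega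
    have k2 : (k : ℝ) ≤ (n + 2) * β := Int.floor_le _
    have k3 : (k : ℝ) ≠ (n + 2) * β := by
      intro h
      have : Irrational (((n + 2 : ℕ) : ℝ) * β) := hβirr.natCast_mul (by omega)
      apply this.ne_int k
      push_cast
      exact h.symm
    have k4 : (k : ℝ) < (n + 2) * β := lt_of_le_of_ne k2 k3
    have k5 : 0 < k := by
      have : (0 : ℝ) < k := lt_trans (by positivity) k1
      exact_mod_cast this
    refine ⟨(k - 1).toNat, ?_⟩
    have hl : (((k - 1).toNat : ℕ) : ℝ) + 1 = k := by
      have : (((k - 1).toNat : ℕ) : ℤ) + 1 = k := by omega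
      exact_mod_cast this
    have : ((ν (k - 1).toNat : ℤ) + 1) = n + 1 := by
      rw [hν, hl, Int.floor_eq_iff]
      push_cast
      have q1 := mul_lt_mul_of_pos_left k1 hα0
      have q2 := mul_lt_mul_of_pos_left k4 hα0
      have q3 : α * ((n + 1) * β) = n + 1 := by rw [mul_left_comm, hαβ, mul_one]
      have q4 : α * ((n + 2) * β) = n + 2 := by rw [mul_left_comm, hαβ, mul_one]
      constructor <;> linarith
    omega

lemma LBeatty_deriv_eq {α : ℝ} (hα : 1 < α) {t : ℝ} (ht : 0 < t) :
    deriv (LBeatty α) t = -((∑' l : ℕ, bf (t * (⌊α * (l + 1)⌋ : ℤ))) / t) := by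
  have ht2 : 0 < t / 2 := by positivity
  have hpos : ∀ l : ℕ, (0 : ℝ) < (⌊α * (l + 1)⌋ : ℤ) := fun l =>
    lt_of_lt_of_le (by positivity) (floor_ge hα l)
  have hle : ∀ s : ℝ, 0 < s → ∀ y, s ≤ y → ∀ l : ℕ, 
      bf (y * (⌊α * (l + 1)⌋ : ℤ)) ≤ bf (s * (l + 1)) := by
    intro s hs y hy l
    have := hpos l
    have := floor_ge hα l
    have hy0 : 0 < y := by linarith
    apply bf_anti (show (0 : ℝ) < _ by positivity) (show (0 : ℝ) < _ by positivity)
    gcongr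
  have hexp : ∀ x : ℝ, 0 < x → 0 < Real.exp x - 1 := by
    intro x hx
    linarith [Real.add_one_le_exp x]
  have H := hasDerivAt_tsum_of_isPreconnected (t := Set.Ioi (t / 2)) (y₀ := t) (y := t)
    (u := fun l : ℕ => bf (t / 2 * (l + 1)) / (t / 2))
    (g := fun (l : ℕ) (y : ℝ) => Real.log (1 - Real.exp (-y * (⌊α * (l + 1)⌋ : ℤ))))
    (g' := fun (l : ℕ) (y : ℝ) => bf (y * (⌊α * (l + 1)⌋ : ℤ)) / y)
    ((bf_summable ht2).div_const _) isOpen_Ioi isPreconnected_Ioi ?_ ?_ ?_ ?_ ?_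
  · have H2 := H.neg
    have : LBeatty α = -(fun z => ∑' l : ℕ, Real.log (1 - Real.exp (-z * (⌊α * (l + 1)⌋ : ℤ)))) := by
      ext z; simp [LBeatty]
    rw [this, H2.deriv, tsum_div_const]
  · intro l y hy
    have hy : t / 2 < y := hy
    have hy0 : 0 < y := by linarith
    have hn := hpos l
    set n : ℝ := ((⌊α * (l + 1)⌋ : ℤ) : ℝ)
    have h1 : HasDerivAt (fun y : ℝ => 1 - Real.exp (-y * n)) (-(Real.exp (-y * n) * (-1 * n))) y :=
      (((hasDerivAt_neg y).mul_const n).exp).const_sub 1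
    have hyn := hexp (y * n) (by positivity)
    have h3 : Real.exp (-y * n) = (Real.exp (y * n))⁻¹ := by rw [← Real.exp_neg]; congr 1; ring
    have h4 : Real.exp (-y * n) < 1 := by rw [Real.exp_lt_one_iff]; nlinarith
    have h2 := h1.log (by linarith)
    convert! h2 using 1
    have h5 : 1 - (Real.exp (y * n))⁻¹ ≠ 0 := by rw [← h3]; linarith
    rw [h3, bf]
    have := Real.exp_pos (y * n)
    have h6 := hyn.ne'
    field_simp
  · intro l y hy
    have hy : t / 2 < y := hy
    have hy0 : 0 < y := by linarith
    have hn := hpos l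
    have hb := bf_nonneg (show 0 < y * (⌊α * (l + 1)⌋ : ℤ) by positivity)
    rw [Real.norm_of_nonneg (by positivity)]
    have := hle _ ht2 y hy.le l
    have hb2 := hb.trans this
    gcongr
  · simp; linarith
  · refine Summable.of_norm_bounded ((bf_summable ht).div_const t) fun l => ?_
    have hn := hpos l
    have hn1 := floor_ge hα l
    have hle := hle t ht t le_rfl l
    set n : ℝ := ((⌊α * (l + 1)⌋ : ℤ) : ℝ)
    have hyn := hexp (t * n) (by positivity)
    have h3 : Real.exp (-t * n) = (Real.exp (t * n))⁻¹ := by rw [← Real.exp_neg]; congr 1; ring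
    have h4 : Real.exp (-t * n) < 1 := by rw [Real.exp_lt_one_iff]; nlinarith
    have h40 := Real.exp_pos (-t * n)
    have h6 : Real.log (1 - Real.exp (-t * n)) ≤ 0 := Real.log_nonpos (by linarith) (by linarith)
    have h7 := Real.one_sub_inv_le_log_of_pos (show 0 < 1 - Real.exp (-t * n) by linarith)
    rw [Real.norm_of_nonpos h6]
    have h5 : 1 - (Real.exp (t * n))⁻¹ ≠ 0 := by rw [← h3]; linarith
    have h8 : (1 - Real.exp (-t * n))⁻¹ - 1 = 1 / (Real.exp (t * n) - 1) := by
      rw [h3]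
      have := Real.exp_pos (t * n)
      have h6 := hyn.ne'
      field_simp
      ring
    have h9 : 1 / (Real.exp (t * n) - 1) ≤ bf (t * n) / t := by
      rw [bf, div_div, mul_comm _ t, mul_div_mul_left _ _ ht.ne']
      have : (0 : ℝ) ≤ l := Nat.cast_nonneg l
      gcongr
      linarith
    have h10 : bf (t * n) / t ≤ bf (t * (l + 1)) / t := by gcongr
    linarith
  · simp; linarith

theorem stmt7 (α : ℝ) (hα : 1 < α) (hirr : Irrational α) :
    (fun t : ℝ =>
        deriv (LBeatty α) t - (-(π ^ 2) / (6 * α * t ^ 2) + (1 - α⁻¹) / (2 * t)))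
      =o[𝓝[>] (0 : ℝ)] (fun t => 1 / t) := by
  have hα0 : 0 < α := by linarith
  have hfr : Int.fract α⁻¹ = α⁻¹ := 
    Int.fract_eq_self.2 ⟨(inv_pos.2 hα0).le, inv_lt_one_of_one_lt₀ hα⟩
  rw [isLittleO_iff_tendsto']
  · have h1 := bT_tendsto α⁻¹ hirr.inv
    have h2 : Tendsto (fun t : ℝ => t / 24) (𝓝[>] 0) (𝓝 0) := by
      have : Continuous (fun t : ℝ => t / 24) := by fun_prop
      simpa using (this.tendsto 0).mono_left (nhdsWithin_le_nhds (s := Set.Ioi 0))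
    have h3 := (h1.sub ((h2.sub bP_tendsto).const_mul α⁻¹)).add
      ((bf_tendsto.const_sub 1).const_mul (α⁻¹ - 1 / 2))
    simp only [sub_self, mul_zero, add_zero] at h3
    refine h3.congr' ?_
    filter_upwards [self_mem_nhdsWithin] with t ht
    have ht : 0 < t := ht
    rw [LBeatty_deriv_eq hα ht, S_eq hα hirr ht, bP_eq ht, hfr]
    field_simp
    ring
  · filter_upwards [self_mem_nhdsWithin] with t ht h
    have ht : 0 < t := ht
    simp at h
    linarith
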